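/- Under the standing assumptions, there exist γ > 0 and C > 0 such that (i) sup_{n≥1} ∫_ℝ |s|^γ dσ^{(n)}(s) ≤ C, and (ii) for every n ≥ 1 and every r > e^{−n}, sup_{s∈ℝ} σ^{(n)}([s − r, s + r]) ≤ C r^γ. -/

import Mathlib

open MeasureTheory Filter Topology

/-- The group of orientation-preserving affine maps of ℝ, modeled as pairs `(r, b)`
with `r > 0`, acting by `t ↦ r * t + b`. -/
abbrev AffP : Type := {p : ℝ × ℝ // 0 < p.1}

/-- The topological support of a measure. -/
def msupport {α : Type*} [TopologicalSpace α] [MeasurableSpace α] (μ : Measure α) : Set α :=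
  {x | ∀ U : Set α, IsOpen U → x ∈ U → 0 < μ U}

/-- `iterLaw lam n` is the law `σ⁽ⁿ⁾` of `(φ₁ ∘ ⋯ ∘ φₙ)(0)` where `φ₁, …, φₙ` are
i.i.d. with law `lam`; `iterLaw lam 0 = δ₀`. -/
noncomputable def iterLaw (lam : Measure AffP) : ℕ → Measure ℝ
  | 0 => Measure.dirac 0
  | n + 1 =>
      Measure.map (fun p : AffP × ℝ => p.1.1.1 * p.2 + p.1.1.2) (lam.prod (iterLaw lam n))

/-- The action of the inverse of an affine map. -/
noncomputable def invAct (φ : AffP) (x : ℝ) : ℝ := (x - φ.1.2) / φ.1.1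

lemma measurable_slope : Measurable fun φ : AffP => φ.1.1 :=
  measurable_fst.comp measurable_subtype_coe

lemma measurable_shift : Measurable fun φ : AffP => φ.1.2 :=
  measurable_snd.comp measurable_subtype_coe

lemma measurable_invAct (x : ℝ) : Measurable fun φ : AffP => invAct φ x :=
  (measurable_const.sub measurable_shift).div measurable_slope

lemma continuous_invAct (φ : AffP) : Continuous (invAct φ) := by
  unfold invAct; fun_prop

lemma not_ae_fixed {lam : Measure AffP}
    (hnofix : ¬ ∃ t : ℝ, ∀ φ ∈ msupport lam, φ.1.1 * t + φ.1.2 = t) (t : ℝ) :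
    ¬ ∀ᵐ φ ∂lam, φ.1.1 * t + φ.1.2 = t := by
  intro h
  refine hnofix ⟨t, fun φ hφ => ?_⟩
  by_contra hne
  have hopen : IsOpen {φ : AffP | φ.1.1 * t + φ.1.2 ≠ t} :=
    isOpen_ne_fun (by fun_prop) continuous_const
  exact (hφ _ hopen hne).ne' (ae_iff.mp h)

/-- Without a common fixed point, and when the slopes do not expand on average, no nonempty
compact set is almost surely stable under the inverse maps. -/
lemma not_stable_compact {lam : Measure AffP}
    (hfix : ∀ t : ℝ, ¬ ∀ᵐ φ ∂lam, φ.1.1 * t + φ.1.2 = t)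
    (hint : Integrable (fun φ : AffP => Real.log φ.1.1) lam)
    (hle : ∫ φ, Real.log φ.1.1 ∂lam ≤ 0) {K : Set ℝ} (hK : IsCompact K) (hne : K.Nonempty)
    (hstable : ∀ x ∈ K, ∀ᵐ φ ∂lam, invAct φ x ∈ K) : False := by
  obtain ⟨m, hm, hmin⟩ := hK.exists_isLeast hne
  obtain ⟨M, hM, hmax⟩ := hK.exists_isGreatest hne
  have hmM : m ≤ M := hmin hM
  have key : ∀ᵐ φ ∂lam, φ.1.1 * m + φ.1.2 ≤ m ∧ M ≤ φ.1.1 * M + φ.1.2 := by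
    filter_upwards [hstable m hm, hstable M hM] with φ h1 h2
    have h3 := hmin h1
    have h4 := hmax h2
    have := φ.2
    unfold invAct at h3 h4
    rw [le_div_iff₀ φ.2] at h3
    rw [div_le_iff₀ φ.2] at h4
    constructor <;> linarith
  rcases hmM.eq_or_lt with rfl | hlt
  · exact hfix m (key.mono fun φ h => le_antisymm h.1 h.2)
  · have hge : ∀ᵐ φ ∂lam, 1 ≤ φ.1.1 := by
      filter_upwards [key] with φ h
      nlinarith [h.1, h.2]
    have hnn : 0 ≤ᵐ[lam] fun φ : AffP => Real.log φ.1.1 :=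
      hge.mono fun φ h => Real.log_nonneg h
    have hz := (integral_eq_zero_iff_of_nonneg_ae hnn hint).mp
      (le_antisymm hle (integral_nonneg_of_ae hnn))
    refine hfix m ?_
    filter_upwards [key, hz] with φ h h0
    have h1 : φ.1.1 = 1 := Real.eq_one_of_pos_of_log_eq_zero φ.2 h0
    rw [h1] at h ⊢
    linarith [h.1, h.2]

/-- The concentration function of a measure on the line. -/
noncomputable def conc (σ : Measure ℝ) (ρ : ℝ) : ℝ := ⨆ s : ℝ, σ.real (Set.Icc (s - ρ) (s + ρ))

section Concentration

variable (σ : Measure ℝ) [IsProbabilityMeasure σ]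

lemma bddAbove_range_ball (ρ : ℝ) :
    BddAbove (Set.range fun s : ℝ => σ.real (Set.Icc (s - ρ) (s + ρ))) :=
  ⟨1, by rintro _ ⟨s, rfl⟩; exact measureReal_le_one⟩

lemma ball_le_conc (s ρ : ℝ) : σ.real (Set.Icc (s - ρ) (s + ρ)) ≤ conc σ ρ :=
  le_ciSup (bddAbove_range_ball σ ρ) s

lemma conc_nonneg (ρ : ℝ) : 0 ≤ conc σ ρ := measureReal_nonneg.trans (ball_le_conc σ 0 ρ)

lemma conc_le_one (ρ : ℝ) : conc σ ρ ≤ 1 := ciSup_le fun _ => measureReal_le_one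

lemma conc_mono : Monotone (conc σ) := fun ρ ρ' h =>
  ciSup_le fun s => (measureReal_mono (Set.Icc_subset_Icc (by linarith) (by linarith))).trans
    (ball_le_conc σ s ρ')

lemma tendsto_conc_atTop : Tendsto (conc σ) atTop (𝓝 1) := by
  have h1 : Tendsto (fun ρ : ℝ => σ.real (Set.Icc (0 - ρ) (0 + ρ))) atTop (𝓝 1) := by
    have hU : (⋃ ρ : ℝ, Set.Icc (0 - ρ) (0 + ρ)) = Set.univ := by
      refine Set.eq_univ_of_forall fun x => Set.mem_iUnion.mpr ⟨|x|, ?_⟩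
      simpa using abs_le.mp le_rfl
    have := tendsto_measure_iUnion_atTop (μ := σ) (s := fun ρ : ℝ => Set.Icc (0 - ρ) (0 + ρ))
      (fun ρ ρ' h => Set.Icc_subset_Icc (by linarith) (by linarith))
    rw [hU, measure_univ] at this
    simpa [Measure.real, Function.comp_def] using (ENNReal.tendsto_toReal ENNReal.one_ne_top).comp this
  exact tendsto_of_tendsto_of_tendsto_of_le_of_le h1 tendsto_const_nhds
    (fun ρ => ball_le_conc σ 0 ρ) (fun ρ => conc_le_one σ ρ)

lemma exists_conc_lt_one (hdirac : ∀ t : ℝ, σ {t}ᶜ ≠ 0) : ∃ ρ : ℝ, 0 < ρ ∧ conc σ ρ < 1 := by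
  have hs0 : σ σ.supportᶜ = 0 := Measure.measure_compl_support
  have hex : ∀ A : Set ℝ, σ A ≠ 0 → ∃ x ∈ A, x ∈ σ.support := by
    intro A hA
    by_contra! h
    exact hA (measure_mono_null (fun x hx => h x hx) hs0)
  obtain ⟨x, -, hx⟩ := hex Set.univ (by simp)
  obtain ⟨y, hyx, hy⟩ := hex {x}ᶜ (hdirac x)
  have hd : 0 < dist x y := dist_pos.mpr fun h => hyx h.symm
  set d := dist x y with hdd
  have hpos : ∀ z ∈ σ.support, 0 < σ.real (Metric.ball z (d / 4)) := by
    intro z hz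
    refine ENNReal.toReal_pos ?_ (measure_ne_top _ _)
    exact ((Measure.mem_support_iff_forall z).mp hz _
      (Metric.ball_mem_nhds z (by positivity))).ne'
  have hcompl : ∀ (s z : ℝ), Disjoint (Set.Icc (s - d / 8) (s + d / 8)) (Metric.ball z (d / 4)) →
      σ.real (Set.Icc (s - d / 8) (s + d / 8)) ≤ 1 - σ.real (Metric.ball z (d / 4)) := by
    intro s z hdis
    have := measureReal_union (μ := σ) hdis Metric.isOpen_ball.measurableSet
    have h1 : σ.real (Set.Icc (s - d / 8) (s + d / 8) ∪ Metric.ball z (d / 4)) ≤ 1 :=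
      measureReal_le_one
    linarith
  refine ⟨d / 8, by positivity, lt_of_le_of_lt (ciSup_le (c := max
    (1 - σ.real (Metric.ball x (d / 4))) (1 - σ.real (Metric.ball y (d / 4)))) fun s => ?_)
    (max_lt (by linarith [hpos x hx]) (by linarith [hpos y hy]))⟩
  by_cases hdis : Disjoint (Set.Icc (s - d / 8) (s + d / 8)) (Metric.ball x (d / 4))
  · exact (hcompl s x hdis).trans (le_max_left _ _)
  · refine (hcompl s y ?_).trans (le_max_right _ _)
    obtain ⟨u, hu, hux⟩ := Set.not_disjoint_iff.mp hdis
    rw [Set.disjoint_left]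
    intro v hv hvy
    rw [Metric.mem_ball] at hux hvy
    have huv : dist u v ≤ d / 4 := by
      rw [Real.dist_eq, abs_le]
      constructor <;> linarith [hu.1, hu.2, hv.1, hv.2]
    have h1 := dist_triangle x u y
    have h2 := dist_triangle u v y
    rw [dist_comm] at hux
    linarith

end Concentration

section Translates

variable {F : ℝ → ℝ}

lemma Monotone.intervalIntegrable_comp_sub (hF : Monotone F) (x a b : ℝ) :
    IntervalIntegrable (fun u => F (u - x)) volume a b :=
  Monotone.intervalIntegrable fun _ _ h => hF (by linarith)

lemma integral_translate_sub (hF : Monotone F) (x T : ℝ) :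
    ∫ u in (-T)..T, (F (u - x) - F u) =
      (∫ u in (-x)..0, F (u - T)) - ∫ u in (-x)..0, F (u + T) := by
  rw [intervalIntegral.integral_sub (hF.intervalIntegrable_comp_sub x _ _) hF.intervalIntegrable,
    intervalIntegral.integral_comp_sub_right, intervalIntegral.integral_comp_sub_right,
    intervalIntegral.integral_comp_add_right,
    intervalIntegral.integral_interval_sub_interval_comm hF.intervalIntegrable
      hF.intervalIntegrable hF.intervalIntegrable]
  congr 2 <;> ring_nf

lemma abs_integral_translate_sub_le (hF : Monotone F) (h0 : ∀ u, 0 ≤ F u) (h1 : ∀ u, F u ≤ 1)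
    (x T : ℝ) : |∫ u in (-T)..T, (F (u - x) - F u)| ≤ 2 * |x| := by
  have hb : ∀ c : ℝ, |∫ u in (-x)..0, F (u + c)| ≤ |x| := by
    intro c
    have := intervalIntegral.norm_integral_le_of_norm_le_const (a := -x) (b := 0) (C := 1)
      (f := fun u => F (u + c)) (fun u _ => by
        rw [Real.norm_eq_abs, abs_of_nonneg (h0 _)]; exact h1 _)
    simpa using this
  rw [integral_translate_sub hF]
  have h2 := hb T
  have h3 := hb (-T)
  simp only [← sub_eq_add_neg] at h3
  rw [abs_le] at *
  constructor <;> linarith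

lemma tendsto_integral_translate_sub (hF : Monotone F) (h0 : ∀ u, 0 ≤ F u) (h1 : ∀ u, F u ≤ 1)
    {p q : ℝ} (hp : Tendsto F atBot (𝓝 p)) (hq : Tendsto F atTop (𝓝 q)) (x : ℝ) :
    Tendsto (fun T : ℝ => ∫ u in (-T)..T, (F (u - x) - F u)) atTop (𝓝 (x * (p - q))) := by
  simp_rw [integral_translate_sub hF]
  have key : ∀ (g : ℝ → ℝ → ℝ) (l : ℝ), (∀ T, Measurable (g T)) → (∀ T u, 0 ≤ g T u) →
      (∀ T u, g T u ≤ 1) → (∀ u, Tendsto (fun T => g T u) atTop (𝓝 l)) →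
      Tendsto (fun T => ∫ u in (-x)..0, g T u) atTop (𝓝 (x * l)) := by
    intro g l hg hg0 hg1 hgl
    have : x * l = ∫ u in (-x)..0, l := by simp
    rw [this]
    refine intervalIntegral.tendsto_integral_filter_of_dominated_convergence (fun _ => 1)
      (Eventually.of_forall fun T => (hg T).aestronglyMeasurable)
      (Eventually.of_forall fun T => Eventually.of_forall fun u _ => ?_)
      (by simp) (Eventually.of_forall fun u _ => hgl u)
    rw [Real.norm_eq_abs, abs_of_nonneg (hg0 T u)]
    exact hg1 T u
  have hm := hF.measurable
  rw [mul_sub]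
  refine (key (fun T u => F (u - T)) p (fun T => by fun_prop) (fun T u => h0 _)
    (fun T u => h1 _) fun u => hp.comp ?_).sub (key (fun T u => F (u + T)) q
    (fun T => by fun_prop) (fun T u => h0 _) (fun T u => h1 _) fun u => hq.comp ?_)
  · exact tendsto_atBot_add_const_left _ u tendsto_neg_atTop_atBot
  · exact tendsto_atTop_add_const_left _ u tendsto_id

/-- A bounded nonconstant monotone function which is subharmonic for a random walk with
nonnegative drift forces the walk to be trivial. -/
lemma ae_eq_zero_of_subharmonic {Ω : Type*} [MeasurableSpace Ω] {μ : Measure Ω}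
    [IsProbabilityMeasure μ] {X : Ω → ℝ} (hX : Measurable X) (hXi : Integrable X μ)
    (hX0 : 0 ≤ ∫ ω, X ω ∂μ) (hF : Monotone F) (h0 : ∀ u, 0 ≤ F u) (h1 : ∀ u, F u ≤ 1)
    (htop : Tendsto F atTop (𝓝 1)) (hlt : ∃ u, F u < 1)
    (hsub : ∀ u, F u ≤ ∫ ω, F (u - X ω) ∂μ) : ∀ᵐ ω ∂μ, X ω = 0 := by
  have hm := hF.measurable
  have hbdd : BddBelow (Set.range F) := ⟨0, by rintro _ ⟨u, rfl⟩; exact h0 u⟩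
  set q : ℝ := ⨅ u, F u with hq
  have hbot : Tendsto F atBot (𝓝 q) := tendsto_atBot_ciInf hF hbdd
  have hq1 : q < 1 := by
    obtain ⟨u, hu⟩ := hlt
    exact (ciInf_le hbdd u).trans_lt hu
  have hq0 : 0 ≤ q := le_ciInf h0
  have hF2 : Monotone fun u => F u ^ 2 := fun a b h => pow_le_pow_left₀ (h0 a) (hF h) 2
  have hF20 : ∀ u, 0 ≤ F u ^ 2 := fun u => sq_nonneg _
  have hF21 : ∀ u, F u ^ 2 ≤ 1 := fun u => pow_le_one₀ (h0 u) (h1 u)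
  set d : ℝ → ℝ → ℝ := fun T x => ∫ u in (-T)..T, (F (u - x) - F u) ^ 2 with hd
  set Φ : ℝ → ℝ → ℝ := fun T x => ∫ u in (-T)..T, (F (u - x) ^ 2 - F u ^ 2) with hΦ
  have hsq_le : ∀ u x, (F (u - x) - F u) ^ 2 ≤ 1 := by
    intro u x
    nlinarith [h0 u, h1 u, h0 (u - x), h1 (u - x)]
  have hdint : ∀ a b x, IntervalIntegrable (fun u => (F (u - x) - F u) ^ 2) volume a b := by
    intro a b x
    refine (intervalIntegrable_const (c := (1 : ℝ))).mono_fun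
      (by fun_prop) (Eventually.of_forall fun u => ?_)
    simpa [abs_of_nonneg (sq_nonneg (F (u - x) - F u))] using hsq_le u x
  have hΦint : ∀ a b x, IntervalIntegrable (fun u => F (u - x) ^ 2 - F u ^ 2) volume a b :=
    fun a b x => (hF2.intervalIntegrable_comp_sub x a b).sub hF2.intervalIntegrable
  have hd_nonneg : ∀ T, 0 ≤ T → ∀ x, 0 ≤ d T x := fun T hT x =>
    intervalIntegral.integral_nonneg (by linarith) fun u _ => sq_nonneg _
  have hd_mono : ∀ T T', 0 ≤ T → T ≤ T' → ∀ x, d T x ≤ d T' x := fun T T' hT hTT x =>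
    intervalIntegral.integral_mono_interval (by linarith) (by linarith) hTT
      (Eventually.of_forall fun u => sq_nonneg _) (hdint _ _ _)
  have hmeas2 : Measurable fun p : ℝ × Ω => F (p.1 - X p.2) := by fun_prop
  have hmeas2' : Measurable fun p : Ω × ℝ => F (p.2 - X p.1) := by fun_prop
  have hd_meas : ∀ T, 0 ≤ T → StronglyMeasurable fun ω => d T (X ω) := by
    intro T hT
    simp only [hd, intervalIntegral.integral_of_le (by linarith : -T ≤ T)]
    refine StronglyMeasurable.integral_prod_right'
      (f := fun p : Ω × ℝ => (F (p.2 - X p.1) - F p.2) ^ 2) ?_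
    exact Measurable.stronglyMeasurable (by fun_prop)
  have hΦ_meas : ∀ T, 0 ≤ T → StronglyMeasurable fun ω => Φ T (X ω) := by
    intro T hT
    simp only [hΦ, intervalIntegral.integral_of_le (by linarith : -T ≤ T)]
    refine StronglyMeasurable.integral_prod_right'
      (f := fun p : Ω × ℝ => F (p.2 - X p.1) ^ 2 - F p.2 ^ 2) ?_
    exact Measurable.stronglyMeasurable (by fun_prop)
  have hΦ_bd : ∀ T x, |Φ T x| ≤ 2 * |x| := fun T x =>
    abs_integral_translate_sub_le hF2 hF20 hF21 x T
  have hΦ_int : ∀ T, 0 ≤ T → Integrable (fun ω => Φ T (X ω)) μ := fun T hT =>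
    (hXi.abs.const_mul 2).mono' (hΦ_meas T hT).aestronglyMeasurable
      (Eventually.of_forall fun ω => hΦ_bd T _)
  have hd_int : ∀ T, 0 ≤ T → Integrable (fun ω => d T (X ω)) μ := by
    intro T hT
    refine (integrable_const (2 * T)).mono' (hd_meas T hT).aestronglyMeasurable
      (Eventually.of_forall fun ω => ?_)
    rw [Real.norm_eq_abs, abs_of_nonneg (hd_nonneg T hT _)]
    have := intervalIntegral.integral_mono_on (by linarith : -T ≤ T) (hdint (-T) T (X ω))
      (intervalIntegrable_const (c := (1 : ℝ))) fun u _ => hsq_le u (X ω)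
    simpa [two_mul] using this
  have hle : ∀ T, 0 ≤ T → ∫ ω, d T (X ω) ∂μ ≤ ∫ ω, Φ T (X ω) ∂μ := by
    intro T hT
    rw [← sub_nonneg, ← integral_sub (hΦ_int T hT) (hd_int T hT)]
    have heq : ∀ ω, Φ T (X ω) - d T (X ω) =
        ∫ u in Set.Ioc (-T) T, 2 * F u * (F (u - X ω) - F u) := by
      intro ω
      rw [hΦ, hd, ← intervalIntegral.integral_of_le (by linarith : -T ≤ T)]
      simp only
      rw [← intervalIntegral.integral_sub (hΦint _ _ _) (hdint _ _ _)]
      congr 1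
      ext u
      ring
    simp_rw [heq]
    rw [integral_integral_swap]
    · refine integral_nonneg fun u => ?_
      simp only
      rw [integral_const_mul, integral_sub]
      · have := hsub u
        simp only [integral_const, probReal_univ, one_smul, Pi.zero_apply]
        exact mul_nonneg (by linarith [h0 u]) (by linarith)
      · refine (integrable_const (1 : ℝ)).mono'
          (hm.comp (measurable_const.sub hX)).aestronglyMeasurable (Eventually.of_forall fun ω => ?_)
        rw [Real.norm_eq_abs, abs_of_nonneg (h0 _)]; exact h1 _
      · exact integrable_const _
    · refine (integrable_const (2 : ℝ)).mono' ?_ (Eventually.of_forall fun p => ?_)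
      · exact Measurable.aestronglyMeasurable (by unfold Function.uncurry; fun_prop)
      · simp only [Function.uncurry, Real.norm_eq_abs]
        have a := h0 p.2; have b := h1 p.2; have c := h0 (p.2 - X p.1); have e := h1 (p.2 - X p.1)
        rw [abs_le]
        constructor <;> nlinarith
  have hlim : Tendsto (fun T : ℝ => ∫ ω, Φ T (X ω) ∂μ) atTop
      (𝓝 (∫ ω, X ω * (q ^ 2 - 1 ^ 2) ∂μ)) := by
    refine tendsto_integral_filter_of_dominated_convergence (fun ω => 2 * |X ω|)
      ((eventually_ge_atTop 0).mono fun T hT => (hΦ_meas T hT).aestronglyMeasurable)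
      (Eventually.of_forall fun T => Eventually.of_forall fun ω => hΦ_bd T _)
      (hXi.abs.const_mul 2) (Eventually.of_forall fun ω => ?_)
    exact tendsto_integral_translate_sub hF2 hF20 hF21 (hbot.pow 2) (htop.pow 2) (X ω)
  have hd_zero : ∀ T, 0 ≤ T → ∀ᵐ ω ∂μ, d T (X ω) = 0 := by
    intro T hT
    have hle0 : ∫ ω, d T (X ω) ∂μ ≤ ∫ ω, X ω * (q ^ 2 - 1 ^ 2) ∂μ :=
      ge_of_tendsto hlim ((eventually_ge_atTop T).mono fun T' hT' =>
        (integral_mono (hd_int T hT) (hd_int T' (hT.trans hT'))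
          fun ω => hd_mono T T' hT hT' _).trans (hle T' (hT.trans hT')))
    rw [integral_mul_const] at hle0
    have hz : ∫ ω, d T (X ω) ∂μ = 0 :=
      le_antisymm (hle0.trans (mul_nonpos_of_nonneg_of_nonpos hX0 (by nlinarith)))
        (integral_nonneg fun ω => hd_nonneg T hT _)
    exact (integral_eq_zero_iff_of_nonneg (fun ω => hd_nonneg T hT _) (hd_int T hT)).mp hz
  have hall : ∀ᵐ ω ∂μ, ∀ n : ℕ, d n (X ω) = 0 :=
    ae_all_iff.mpr fun n => hd_zero n n.cast_nonneg
  filter_upwards [hall] with ω hω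
  have hz : ∀ n : ℕ, ∫ u in (-(n : ℝ))..n, (F (u - X ω) - F u) = 0 := by
    intro n
    have hn : -(n : ℝ) ≤ n := by linarith [n.cast_nonneg (α := ℝ)]
    have h2 := hω n
    simp only [hd] at h2
    rw [intervalIntegral.integral_eq_zero_iff_of_le_of_nonneg_ae hn
      (Eventually.of_forall fun u => sq_nonneg _) (hdint _ _ _)] at h2
    rw [intervalIntegral.integral_of_le hn]
    refine integral_eq_zero_of_ae (h2.mono fun u hu => ?_)
    simpa using hu
  have h3 := (tendsto_integral_translate_sub hF h0 h1 hbot htop (X ω)).comp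
    tendsto_natCast_atTop_atTop
  have h4 : X ω * (q - 1) = 0 := by
    refine tendsto_nhds_unique h3 ?_
    simp only [Function.comp_def, hz]
    exact tendsto_const_nhds
  rcases mul_eq_zero.mp h4 with h | h
  · exact h
  · linarith

end Translates

/-- `σ` is stationary for the random affine map of law `lam`. -/
def IsStationaryFor (lam : Measure AffP) (σ : Measure ℝ) : Prop :=
  ∀ A : Set ℝ, MeasurableSet A →
    σ A = ∫⁻ φ : AffP, σ ((fun t => φ.1.1 * t + φ.1.2) ⁻¹' A) ∂lam

lemma preimage_Icc_affine (φ : AffP) (s ρ : ℝ) :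
    (fun t => φ.1.1 * t + φ.1.2) ⁻¹' Set.Icc (s - ρ) (s + ρ) =
      Set.Icc (invAct φ s - ρ / φ.1.1) (invAct φ s + ρ / φ.1.1) := by
  have h := φ.2
  ext t
  simp only [Set.mem_preimage, Set.mem_Icc, invAct, ← sub_div, ← add_div, div_le_iff₀ h,
    le_div_iff₀ h]
  constructor <;> rintro ⟨h1, h2⟩ <;> constructor <;> linarith

lemma IsStationaryFor.eq_map {lam : Measure AffP} {σ : Measure ℝ}
    [IsProbabilityMeasure σ] (hstat : IsStationaryFor lam σ) :
    σ = (lam.prod σ).map fun p : AffP × ℝ => p.1.1.1 * p.2 + p.1.1.2 := by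
  have h1 : Measurable fun p : AffP × ℝ => p.1.1.1 * p.2 + p.1.1.2 := by fun_prop
  ext A hA
  rw [Measure.map_apply h1 hA, Measure.prod_apply (h1 hA), hstat A hA]
  rfl

/-- A decreasing profile on the line. -/
noncomputable def decay (γ : ℝ) (x : ℝ) : ℝ := (1 + |x|) ^ (-γ)

lemma decay_pos (γ x : ℝ) : 0 < decay γ x := Real.rpow_pos_of_pos (by positivity) _

lemma decay_le_one {γ : ℝ} (hγ : 0 ≤ γ) (x : ℝ) : decay γ x ≤ 1 :=
  Real.rpow_le_one_of_one_le_of_nonpos (by linarith [abs_nonneg x]) (by linarith)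

lemma continuous_decay (γ : ℝ) : Continuous (decay γ) :=
  (continuous_const.add continuous_abs).rpow_const fun x =>
    Or.inl (by linarith [abs_nonneg x] : 0 < 1 + |x|).ne'

lemma tendsto_decay {γ : ℝ} (hγ : 0 < γ) : Tendsto (decay γ) (comap abs atTop) (𝓝 0) :=
  (tendsto_rpow_neg_atTop hγ).comp (tendsto_atTop_add_const_left _ 1 tendsto_comap)

lemma tendsto_abs_sub_const (t : ℝ) :
    Tendsto (fun x : ℝ => x - t) (comap abs atTop) (comap abs atTop) := by
  rw [tendsto_comap_iff]
  refine tendsto_atTop_mono (f := fun x : ℝ => |x| - |t|) (fun x => abs_sub_abs_le_abs_sub x t) ?_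
  exact tendsto_atTop_add_const_right _ (-|t|) tendsto_comap

lemma IsStationaryFor.compl_singleton_ne_zero {lam : Measure AffP} {σ : Measure ℝ}
    [IsProbabilityMeasure σ] (hstat : IsStationaryFor lam σ)
    (hfix : ∀ t : ℝ, ¬ ∀ᵐ φ ∂lam, φ.1.1 * t + φ.1.2 = t) (t : ℝ) : σ {t}ᶜ ≠ 0 := by
  intro h0
  have hat : σ {t} = 1 := (prob_compl_eq_zero_iff (measurableSet_singleton t)).mp h0
  have hmeas : Measurable fun φ : AffP => σ ((fun u => φ.1.1 * u + φ.1.2) ⁻¹' {t}ᶜ) := by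
    refine measurable_measure_prodMk_left
      (s := (fun p : AffP × ℝ => p.1.1.1 * p.2 + p.1.1.2) ⁻¹' {t}ᶜ) ?_
    have h1 : Measurable fun p : AffP × ℝ => p.1.1.1 * p.2 + p.1.1.2 := by fun_prop
    exact h1 (measurableSet_singleton t).compl
  have h := hstat {t}ᶜ (measurableSet_singleton t).compl
  rw [h0, eq_comm, lintegral_eq_zero_iff hmeas] at h
  refine hfix t (h.mono fun φ hφ => ?_)
  by_contra hne
  have : σ {t} ≤ 0 := (measure_mono (by simpa using hne)).trans_eq hφ
  simp [hat] at this

section Stationary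

variable {lam : Measure AffP} [IsProbabilityMeasure lam] {σ : Measure ℝ} [IsProbabilityMeasure σ]

lemma IsStationaryFor.conc_le (hstat : IsStationaryFor lam σ) (ρ : ℝ) :
    conc σ ρ ≤ ∫ φ, conc σ (ρ / φ.1.1) ∂lam := by
  have hm : Measurable fun φ : AffP => conc σ (ρ / φ.1.1) :=
    (conc_mono σ).measurable.comp (measurable_const.div measurable_slope)
  refine ciSup_le fun s => ?_
  rw [Measure.real, hstat _ measurableSet_Icc, integral_eq_lintegral_of_nonneg_ae
    (Eventually.of_forall fun φ => conc_nonneg σ _) hm.aestronglyMeasurable]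
  refine ENNReal.toReal_mono ?_ (lintegral_mono fun φ => ?_)
  · refine ne_top_of_le_ne_top ENNReal.one_ne_top ((lintegral_mono (g := fun _ => 1)
      fun φ => ?_).trans (by simp))
    exact ENNReal.ofReal_le_one.mpr (conc_le_one σ _)
  · rw [preimage_Icc_affine, ← ENNReal.ofReal_toReal (measure_ne_top σ _)]
    exact ENNReal.ofReal_le_ofReal (ball_le_conc σ _ _)

/-- A stationary probability measure cannot exist for a random translation without fixed points. -/
lemma IsStationaryFor.not_ae_log_eq_zero (hstat : IsStationaryFor lam σ)
    (hfix : ∀ t : ℝ, ¬ ∀ᵐ φ ∂lam, φ.1.1 * t + φ.1.2 = t) :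
    ¬ ∀ᵐ φ ∂lam, Real.log φ.1.1 = 0 := by
  intro hlog
  have hone : ∀ᵐ φ ∂lam, φ.1.1 = 1 := hlog.mono fun φ h =>
    Real.eq_one_of_pos_of_log_eq_zero φ.2 h
  set V := decay 1 with hV
  have hVc : Continuous V := continuous_decay 1
  have hV1 : ∀ x, ‖V x‖ ≤ 1 := fun x => by
    rw [Real.norm_eq_abs, abs_of_pos (decay_pos 1 x)]; exact decay_le_one zero_le_one x
  set f : ℝ → ℝ := fun x => ∫ t, V (x - t) ∂σ with hf
  have hfc : Continuous f := continuous_of_dominated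
    (fun x => (hVc.comp (continuous_const.sub continuous_id)).aestronglyMeasurable)
    (fun x => Eventually.of_forall fun t => hV1 _) (integrable_const 1)
    (Eventually.of_forall fun t => hVc.comp (continuous_id.sub continuous_const))
  have hVint : ∀ x, Integrable (fun t => V (x - t)) σ := fun x => (integrable_const (1 : ℝ)).mono'
    (hVc.comp (continuous_const.sub continuous_id)).aestronglyMeasurable
    (Eventually.of_forall fun t => hV1 _)
  have hfpos : ∀ x, 0 < f x := fun x => by
    refine (integral_pos_iff_support_of_nonneg (fun t => (decay_pos 1 _).le) (hVint x)).mpr ?_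
    have : Function.support (fun t => V (x - t)) = Set.univ :=
      Set.eq_univ_of_forall fun t => (decay_pos 1 _).ne'
    rw [this]
    simp
  have hf1 : ∀ x, ‖f x‖ ≤ 1 := fun x => by
    simpa using norm_integral_le_of_norm_le_const (μ := σ) (f := fun t => V (x - t)) (C := 1)
      (Eventually.of_forall fun t => hV1 _)
  have hf0 : Tendsto f (comap abs atTop) (𝓝 0) := by
    rw [← integral_zero ℝ ℝ (μ := σ)]
    exact tendsto_integral_filter_of_dominated_convergence (fun _ => 1)
      (Eventually.of_forall fun x =>
        (hVc.comp (continuous_const.sub continuous_id)).aestronglyMeasurable)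
      (Eventually.of_forall fun x => Eventually.of_forall fun t => hV1 _) (integrable_const 1)
      (Eventually.of_forall fun t => (tendsto_decay one_pos).comp (tendsto_abs_sub_const t))
  have hharm : ∀ x, f x = ∫ φ, f (invAct φ x) ∂lam := by
    intro x
    have h1 : Measurable fun p : AffP × ℝ => p.1.1.1 * p.2 + p.1.1.2 := by fun_prop
    have hVs : Continuous fun t => V (x - t) := hVc.comp (continuous_const.sub continuous_id)
    calc f x = ∫ t, V (x - t) ∂((lam.prod σ).map fun p : AffP × ℝ => p.1.1.1 * p.2 + p.1.1.2) := by
          rw [← hstat.eq_map]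
      _ = ∫ p, V (x - (p.1.1.1 * p.2 + p.1.1.2)) ∂(lam.prod σ) :=
          integral_map h1.aemeasurable hVs.aestronglyMeasurable
      _ = ∫ φ, ∫ t, V (x - (φ.1.1 * t + φ.1.2)) ∂σ ∂lam := by
          refine integral_prod _ ((integrable_const (1 : ℝ)).mono'
            (hVs.measurable.comp h1).aestronglyMeasurable (Eventually.of_forall fun t => hV1 _))
      _ = ∫ φ, f (invAct φ x) ∂lam := by
          refine integral_congr_ae (hone.mono fun φ h => ?_)
          simp only [hf, invAct, h]
          congr 1
          ext t
          congr 1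
          ring
  obtain ⟨x₀, hx₀⟩ : ∃ x₀, ∀ y, f y ≤ f x₀ := by
    refine hfc.exists_forall_ge' 0 ?_
    have : (cocompact ℝ) ≤ comap abs atTop := by
      rw [← Metric.cobounded_eq_cocompact, ← comap_norm_atTop]
      rfl
    exact ((hf0.mono_left this).eventually (ge_mem_nhds (hfpos 0)))
  have hfint : ∀ x, Integrable (fun φ => f (invAct φ x)) lam := fun x =>
    (integrable_const (1 : ℝ)).mono'
      (hfc.measurable.comp (measurable_invAct x)).aestronglyMeasurable
      (Eventually.of_forall fun φ => hf1 _)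
  refine not_stable_compact hfix ((integrable_zero _ _ _).congr (hlog.mono fun φ h => h.symm))
    (integral_eq_zero_of_ae hlog).le (K := {x | f x = f x₀}) ?_ ⟨x₀, rfl⟩ ?_
  · refine Metric.isCompact_of_isClosed_isBounded (isClosed_eq hfc continuous_const) ?_
    obtain ⟨R, hR⟩ := mem_comap.mp (hf0.eventually (gt_mem_nhds (hfpos x₀)))
    obtain ⟨a, ha⟩ := mem_atTop_sets.mp hR.1
    refine (Metric.isBounded_closedBall (x := (0 : ℝ)) (r := a)).subset fun x hx => ?_
    rw [mem_closedBall_zero_iff, Real.norm_eq_abs]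
    by_contra! hlt
    have h1 : f x < f x₀ := hR.2 (ha _ hlt.le)
    exact h1.ne hx
  · intro x hx
    have h0 : ∫ φ, (f x₀ - f (invAct φ x)) ∂lam = 0 := by
      rw [integral_sub (integrable_const _) (hfint x), ← hharm x, hx]
      simp
    have h2 := (integral_eq_zero_iff_of_nonneg (fun φ => sub_nonneg.mpr (hx₀ (invAct φ x)))
      ((integrable_const _).sub (hfint x))).mp h0
    filter_upwards [h2] with φ h
    exact (sub_eq_zero.mp h).symm

/-- The existence of a stationary probability measure forces contraction on average. -/
lemma IsStationaryFor.integral_log_neg (hstat : IsStationaryFor lam σ)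
    (hfix : ∀ t : ℝ, ¬ ∀ᵐ φ ∂lam, φ.1.1 * t + φ.1.2 = t)
    (hint : Integrable (fun φ : AffP => Real.log φ.1.1) lam) :
    ∫ φ, Real.log φ.1.1 ∂lam < 0 := by
  by_contra! h
  refine hstat.not_ae_log_eq_zero hfix (ae_eq_zero_of_subharmonic
    (F := fun u => conc σ (Real.exp u)) measurable_slope.log hint h
    ((conc_mono σ).comp Real.exp_monotone) (fun u => conc_nonneg σ _) (fun u => conc_le_one σ _)
    ((tendsto_conc_atTop σ).comp Real.tendsto_exp_atTop) ?_ fun u => ?_)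
  · obtain ⟨ρ, hρ, h1⟩ := exists_conc_lt_one σ (hstat.compl_singleton_ne_zero hfix)
    exact ⟨Real.log ρ, by rwa [Real.exp_log hρ]⟩
  · refine (hstat.conc_le _).trans_eq (integral_congr_ae (Eventually.of_forall fun φ => ?_))
    simp only [Real.exp_sub, Real.exp_log φ.2]

end Stationary

lemma integrable_moments {lam : Measure AffP} {ε : ℝ}
    (hmom : ∫⁻ φ : AffP, ENNReal.ofReal (φ.1.1 ^ ε + φ.1.1 ^ (-ε) + |φ.1.2| ^ ε) ∂lam < ⊤) :
    Integrable (fun φ : AffP => φ.1.1 ^ ε) lam ∧ Integrable (fun φ : AffP => φ.1.1 ^ (-ε)) lam ∧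
      Integrable (fun φ : AffP => |φ.1.2| ^ ε) lam := by
  have h1 : Measurable fun φ : AffP => φ.1.1 ^ ε := measurable_slope.pow_const _
  have h2 : Measurable fun φ : AffP => φ.1.1 ^ (-ε) := measurable_slope.pow_const _
  have h3 : Measurable fun φ : AffP => |φ.1.2| ^ ε := measurable_shift.abs.pow_const _
  have p1 : ∀ φ : AffP, 0 ≤ φ.1.1 ^ ε := fun φ => Real.rpow_nonneg φ.2.le _
  have p2 : ∀ φ : AffP, 0 ≤ φ.1.1 ^ (-ε) := fun φ => Real.rpow_nonneg φ.2.le _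
  have p3 : ∀ φ : AffP, 0 ≤ |φ.1.2| ^ ε := fun φ => Real.rpow_nonneg (abs_nonneg _) _
  have hsum : Integrable (fun φ : AffP => φ.1.1 ^ ε + φ.1.1 ^ (-ε) + |φ.1.2| ^ ε) lam := by
    refine ⟨((h1.add h2).add h3).aestronglyMeasurable, ?_⟩
    rw [hasFiniteIntegral_iff_ofReal
      (Eventually.of_forall fun φ => add_nonneg (add_nonneg (p1 φ) (p2 φ)) (p3 φ))]
    exact hmom
  refine ⟨hsum.mono' h1.aestronglyMeasurable (Eventually.of_forall fun φ => ?_),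
    hsum.mono' h2.aestronglyMeasurable (Eventually.of_forall fun φ => ?_),
    hsum.mono' h3.aestronglyMeasurable (Eventually.of_forall fun φ => ?_)⟩
  · rw [Real.norm_of_nonneg (p1 φ)]; linarith [p2 φ, p3 φ]
  · rw [Real.norm_of_nonneg (p2 φ)]; linarith [p1 φ, p3 φ]
  · rw [Real.norm_of_nonneg (p3 φ)]; linarith [p1 φ, p2 φ]

lemma rpow_le_one_add_rpow {x s t : ℝ} (hx : 0 ≤ x) (hs : 0 ≤ s) (hst : s ≤ t) :
    x ^ s ≤ 1 + x ^ t := by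
  rcases le_total x 1 with h | h
  · linarith [Real.rpow_le_one hx h hs, Real.rpow_nonneg hx t]
  · linarith [Real.rpow_le_rpow_of_exponent_le h hst]

lemma integrableExpSet_log_slope (lam : Measure AffP) :
    ProbabilityTheory.integrableExpSet (fun φ : AffP => Real.log φ.1.1) lam =
      {t | Integrable (fun φ : AffP => φ.1.1 ^ t) lam} := by
  ext t
  simp only [ProbabilityTheory.integrableExpSet, Set.mem_ofPred_eq]
  refine integrable_congr (Eventually.of_forall fun φ => ?_)
  simp only [Real.rpow_def_of_pos φ.2, mul_comm]

lemma zero_mem_interior_integrableExpSet {lam : Measure AffP} {ε : ℝ} (hε : 0 < ε)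
    (h1 : Integrable (fun φ : AffP => φ.1.1 ^ ε) lam)
    (h2 : Integrable (fun φ : AffP => φ.1.1 ^ (-ε)) lam) :
    0 ∈ interior (ProbabilityTheory.integrableExpSet (fun φ : AffP => Real.log φ.1.1) lam) := by
  have hsub : Set.Icc (-ε) ε ⊆
      ProbabilityTheory.integrableExpSet (fun φ : AffP => Real.log φ.1.1) lam :=
    ProbabilityTheory.convex_integrableExpSet.ordConnected.out
      (by rw [integrableExpSet_log_slope]; exact h2) (by rw [integrableExpSet_log_slope]; exact h1)
  exact mem_interior_iff_mem_nhds.mpr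
    (mem_of_superset (Icc_mem_nhds (by linarith) hε) hsub)

/-- Contraction on average yields a contracting moment of small exponent. -/
lemma exists_contracting_moment {lam : Measure AffP} [IsProbabilityMeasure lam] {ε : ℝ}
    (h0 : 0 ∈ interior (ProbabilityTheory.integrableExpSet (fun φ : AffP => Real.log φ.1.1) lam))
    (hneg : ∫ φ, Real.log φ.1.1 ∂lam < 0) (hε : 0 < ε) :
    ∃ γ : ℝ, 0 < γ ∧ γ ≤ ε ∧ Integrable (fun φ : AffP => φ.1.1 ^ γ) lam ∧
      ∫ φ, φ.1.1 ^ γ ∂lam < 1 := by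
  have hder := ProbabilityTheory.hasDerivAt_mgf h0
  simp only [zero_mul, Real.exp_zero, mul_one] at hder
  have h1 := hder.tendsto_slope_zero_right
  have h2 := (h1.eventually (gt_mem_nhds hneg)).and (eventually_nhdsWithin_of_eventually_nhds
    ((eventually_mem_set.mpr (mem_interior_iff_mem_nhds.mp h0)).and (ge_mem_nhds hε)))
  obtain ⟨γ, ⟨hγ1, hγ2, hγ3⟩, hγ0⟩ := (h2.and self_mem_nhdsWithin).exists
  have hγ0 : 0 < γ := hγ0
  refine ⟨γ, hγ0, hγ3, ?_, ?_⟩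
  · rw [integrableExpSet_log_slope] at hγ2; exact hγ2
  · rw [zero_add, ProbabilityTheory.mgf_zero, smul_eq_mul] at hγ1
    have h3 : ProbabilityTheory.mgf (fun φ : AffP => Real.log φ.1.1) lam γ =
        ∫ φ, φ.1.1 ^ γ ∂lam := by
      unfold ProbabilityTheory.mgf
      refine integral_congr_ae (Eventually.of_forall fun φ => ?_)
      simp only [Real.rpow_def_of_pos φ.2, mul_comm]
    rw [← h3]
    by_contra! hge
    have : 0 ≤ γ⁻¹ * (ProbabilityTheory.mgf (fun φ : AffP => Real.log φ.1.1) lam γ - 1) :=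
      mul_nonneg (by positivity) (by linarith)
    linarith

section Moments

variable {lam : Measure AffP} [IsProbabilityMeasure lam] {γ : ℝ}

lemma measurable_affine : Measurable fun p : AffP × ℝ => p.1.1.1 * p.2 + p.1.1.2 := by fun_prop

instance isProbabilityMeasure_iterLaw (n : ℕ) : IsProbabilityMeasure (iterLaw lam n) := by
  induction n with
  | zero => unfold iterLaw; infer_instance
  | succ n ih =>
    unfold iterLaw
    exact Measure.isProbabilityMeasure_map measurable_affine.aemeasurable

/-- The `γ`-moments of the iterates are uniformly bounded. -/
lemma lintegral_rpow_iterLaw_le (hγ : 0 < γ) (hγ1 : γ ≤ 1)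
    (hr : Integrable (fun φ : AffP => φ.1.1 ^ γ) lam) (hκ : ∫ φ, φ.1.1 ^ γ ∂lam < 1)
    (hb : Integrable (fun φ : AffP => |φ.1.2| ^ γ) lam) (n : ℕ) :
    ∫⁻ s, ENNReal.ofReal (|s| ^ γ) ∂(iterLaw lam n) ≤
      ENNReal.ofReal ((∫ φ, |φ.1.2| ^ γ ∂lam) / (1 - ∫ φ, φ.1.1 ^ γ ∂lam)) := by
  set κ := ∫ φ, φ.1.1 ^ γ ∂lam
  set B := ∫ φ, |φ.1.2| ^ γ ∂lam with hB
  have hB0 : 0 ≤ B := integral_nonneg fun φ => Real.rpow_nonneg (abs_nonneg _) _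
  have hκ0 : 0 ≤ κ := integral_nonneg fun φ => Real.rpow_nonneg φ.2.le _
  have hM0 : 0 ≤ B / (1 - κ) := div_nonneg hB0 (by linarith)
  have hmeas : Measurable fun s : ℝ => ENNReal.ofReal (|s| ^ γ) := by fun_prop
  induction n with
  | zero => simp [iterLaw, lintegral_dirac' _ hmeas, Real.zero_rpow hγ.ne']
  | succ n ih =>
    have hstep : ∀ φ : AffP, ∫⁻ s, ENNReal.ofReal (|φ.1.1 * s + φ.1.2| ^ γ) ∂(iterLaw lam n) ≤
        ENNReal.ofReal (φ.1.1 ^ γ * (B / (1 - κ)) + |φ.1.2| ^ γ) := by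
      intro φ
      have hr0 : 0 ≤ φ.1.1 ^ γ := Real.rpow_nonneg φ.2.le _
      have hb0 : 0 ≤ |φ.1.2| ^ γ := Real.rpow_nonneg (abs_nonneg _) _
      calc ∫⁻ s, ENNReal.ofReal (|φ.1.1 * s + φ.1.2| ^ γ) ∂(iterLaw lam n)
          ≤ ∫⁻ s, (ENNReal.ofReal (φ.1.1 ^ γ) * ENNReal.ofReal (|s| ^ γ) +
              ENNReal.ofReal (|φ.1.2| ^ γ)) ∂(iterLaw lam n) := by
            refine lintegral_mono fun s => ?_
            rw [← ENNReal.ofReal_mul hr0,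
              ← ENNReal.ofReal_add (by positivity) hb0]
            refine ENNReal.ofReal_le_ofReal ?_
            calc |φ.1.1 * s + φ.1.2| ^ γ ≤ (φ.1.1 * |s| + |φ.1.2|) ^ γ := by
                  refine Real.rpow_le_rpow (abs_nonneg _) ?_ hγ.le
                  refine (abs_add_le _ _).trans_eq ?_
                  rw [abs_mul, abs_of_pos φ.2]
              _ ≤ (φ.1.1 * |s|) ^ γ + |φ.1.2| ^ γ :=
                  Real.rpow_add_le_add_rpow (mul_nonneg φ.2.le (abs_nonneg s)) (abs_nonneg _)
                    hγ.le hγ1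
              _ = φ.1.1 ^ γ * |s| ^ γ + |φ.1.2| ^ γ := by
                  rw [Real.mul_rpow φ.2.le (abs_nonneg s)]
        _ = ENNReal.ofReal (φ.1.1 ^ γ) * ∫⁻ s, ENNReal.ofReal (|s| ^ γ) ∂(iterLaw lam n) +
              ENNReal.ofReal (|φ.1.2| ^ γ) := by
            rw [lintegral_add_right _ measurable_const, lintegral_const_mul _ hmeas]
            simp
        _ ≤ _ := by
            rw [ENNReal.ofReal_add (by positivity) hb0, ENNReal.ofReal_mul hr0]
            gcongr
    calc ∫⁻ s, ENNReal.ofReal (|s| ^ γ) ∂(iterLaw lam (n + 1))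
        = ∫⁻ φ, ∫⁻ s, ENNReal.ofReal (|φ.1.1 * s + φ.1.2| ^ γ) ∂(iterLaw lam n) ∂lam := by
          rw [iterLaw, lintegral_map hmeas measurable_affine]
          exact lintegral_prod _ (hmeas.comp measurable_affine).aemeasurable
      _ ≤ ∫⁻ φ, ENNReal.ofReal (φ.1.1 ^ γ * (B / (1 - κ)) + |φ.1.2| ^ γ) ∂lam :=
          lintegral_mono hstep
      _ = ENNReal.ofReal (∫ φ, (φ.1.1 ^ γ * (B / (1 - κ)) + |φ.1.2| ^ γ) ∂lam) := by
          refine (ofReal_integral_eq_lintegral_ofReal ((hr.mul_const _).add hb)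
            (Eventually.of_forall fun φ => ?_)).symm
          exact add_nonneg (mul_nonneg (Real.rpow_nonneg φ.2.le _) hM0)
            (Real.rpow_nonneg (abs_nonneg _) _)
      _ = ENNReal.ofReal (B / (1 - κ)) := by
          rw [integral_add (hr.mul_const _) hb, integral_mul_const, ← hB]
          congr 1
          have : 1 - κ ≠ 0 := by linarith
          change κ * _ + B = _
          field_simp
          ring

/-- Balls centred far from the origin have small mass. -/
lemma iterLaw_Icc_le_decay (hγ : 0 < γ) (hγ1 : γ ≤ 1) {δ M : ℝ} (hδ : 0 < δ) (hδ1 : δ ≤ 1)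
    (hM : 0 ≤ M) {n : ℕ}
    (hmom : ∫⁻ s, ENNReal.ofReal (|s| ^ γ) ∂(iterLaw lam n) ≤ ENNReal.ofReal M)
    (x : ℝ) {ρ : ℝ} (hρ : 0 < ρ) :
    iterLaw lam n (Set.Icc (x - ρ) (x + ρ)) ≤
      ENNReal.ofReal ((4 * M + 2) * (decay γ x + ρ ^ δ)) := by
  have hd := decay_pos γ x
  have hρδ : 0 < ρ ^ δ := Real.rpow_pos_of_pos hρ _
  have half : ∀ t : ℝ, 0 < t → t ≤ 1 → (1 / 2 : ℝ) ≤ (1 / 2 : ℝ) ^ t := fun t ht ht1 => by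
    simpa using Real.rpow_le_rpow_of_exponent_ge (by norm_num : (0 : ℝ) < 1 / 2) (by norm_num) ht1
  by_cases hlarge : 1 / 2 ≤ decay γ x + ρ ^ δ
  · refine prob_le_one.trans ?_
    rw [← ENNReal.ofReal_one]
    exact ENNReal.ofReal_le_ofReal (by nlinarith)
  push Not at hlarge
  have hρ2 : ρ < 1 / 2 := by
    by_contra! h
    have := Real.rpow_le_rpow (by norm_num) h hδ.le
    linarith [half δ hδ hδ1]
  have hx : 1 < |x| := by
    by_contra! h
    have h2 : (2 : ℝ) ^ (-γ) ≤ decay γ x :=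
      Real.rpow_le_rpow_of_nonpos (by positivity) (by linarith) (by linarith)
    have h3 : (2 : ℝ) ^ (-γ) = (1 / 2 : ℝ) ^ γ := by
      rw [Real.rpow_neg (by norm_num), ← Real.inv_rpow (by norm_num)]
      norm_num
    linarith [half γ hγ hγ1]
  have hy : 0 < (|x| / 2) ^ γ := Real.rpow_pos_of_pos (by linarith) _
  have hsub : Set.Icc (x - ρ) (x + ρ) ⊆
      {s | ENNReal.ofReal ((|x| / 2) ^ γ) ≤ ENNReal.ofReal (|s| ^ γ)} := by
    intro s hs
    refine ENNReal.ofReal_le_ofReal (Real.rpow_le_rpow (by positivity) ?_ hγ.le)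
    have h1 : |x - s| ≤ ρ := abs_le.mpr ⟨by linarith [hs.2], by linarith [hs.1]⟩
    have h2 := abs_sub_abs_le_abs_sub x s
    linarith
  have hmarkov := (mul_meas_ge_le_lintegral (μ := iterLaw lam n)
    (f := fun s => ENNReal.ofReal (|s| ^ γ)) (by fun_prop)
    (ENNReal.ofReal ((|x| / 2) ^ γ))).trans hmom
  have hfin : iterLaw lam n (Set.Icc (x - ρ) (x + ρ)) ≤ ENNReal.ofReal (M / (|x| / 2) ^ γ) := by
    rw [ENNReal.ofReal_div_of_pos hy, ENNReal.le_div_iff_mul_le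
      (Or.inl (by simpa using hy)) (Or.inl ENNReal.ofReal_ne_top), mul_comm]
    exact (mul_le_mul_right (measure_mono hsub) _).trans hmarkov
  refine hfin.trans (ENNReal.ofReal_le_ofReal ?_)
  have hdec : (1 / 4) * ((|x| / 2) ^ γ)⁻¹ ≤ decay γ x := by
    have h1 : (4 * (|x| / 2)) ^ (-γ) ≤ decay γ x :=
      Real.rpow_le_rpow_of_nonpos (by positivity) (by linarith) (by linarith)
    rw [Real.mul_rpow (by norm_num) (by positivity),
      Real.rpow_neg (by positivity : 0 ≤ |x| / 2)] at h1
    have h2 : (1 / 4 : ℝ) ≤ 4 ^ (-γ) := by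
      have := Real.rpow_le_rpow_of_exponent_le (by norm_num : (1 : ℝ) ≤ 4)
        (by linarith : (-1 : ℝ) ≤ -γ)
      rw [Real.rpow_neg_one] at this
      linarith
    refine le_trans ?_ h1
    gcongr
  rw [div_eq_mul_inv]
  nlinarith [mul_nonneg hM (sub_nonneg.mpr hdec), mul_nonneg hM hρδ.le]

end Moments

/-- The transition operator of the random walk on the line driven by the inverse maps. -/
noncomputable def backOp (lam : Measure AffP) (f : ℝ → ℝ) (x : ℝ) : ℝ :=
  ∫ φ, f (invAct φ x) ∂lam

section BackOp

variable {lam : Measure AffP} [IsProbabilityMeasure lam] {γ : ℝ}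

lemma integrable_comp_invAct {f : ℝ → ℝ} (hf : Continuous f) {C : ℝ} (h0 : ∀ x, 0 ≤ f x)
    (h1 : ∀ x, f x ≤ C) (x : ℝ) : Integrable (fun φ => f (invAct φ x)) lam :=
  (integrable_const C).mono' (hf.measurable.comp (measurable_invAct x)).aestronglyMeasurable
    (Eventually.of_forall fun φ => by rw [Real.norm_of_nonneg (h0 _)]; exact h1 _)

lemma continuous_backOp {f : ℝ → ℝ} (hf : Continuous f) {C : ℝ} (h0 : ∀ x, 0 ≤ f x)
    (h1 : ∀ x, f x ≤ C) : Continuous (backOp lam f) :=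
  continuous_of_dominated (bound := fun _ => C)
    (fun x => (hf.measurable.comp (measurable_invAct x)).aestronglyMeasurable)
    (fun x => Eventually.of_forall fun φ => by rw [Real.norm_of_nonneg (h0 _)]; exact h1 _)
    (integrable_const C) (Eventually.of_forall fun φ => hf.comp (continuous_invAct φ))

/-- Continuous functions with values in the unit interval. -/
def IsUnitProfile (f : ℝ → ℝ) : Prop := Continuous f ∧ (∀ x, 0 ≤ f x) ∧ ∀ x, f x ≤ 1

lemma IsUnitProfile.integrable {f : ℝ → ℝ} (hf : IsUnitProfile f) (x : ℝ) :
    Integrable (fun φ => f (invAct φ x)) lam :=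
  integrable_comp_invAct hf.1 hf.2.1 hf.2.2 x

lemma IsUnitProfile.backOp {f : ℝ → ℝ} (hf : IsUnitProfile f) : IsUnitProfile (backOp lam f) := by
  refine ⟨continuous_backOp hf.1 hf.2.1 hf.2.2, fun x => integral_nonneg fun φ => hf.2.1 _,
    fun x => ?_⟩
  simpa using! integral_mono (hf.integrable (lam := lam) x) (integrable_const (1 : ℝ))
    fun φ => hf.2.2 _

lemma IsUnitProfile.iterate {f : ℝ → ℝ} (hf : IsUnitProfile f) (k : ℕ) :
    IsUnitProfile ((_root_.backOp lam)^[k] f) := by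
  induction k with
  | zero => exact hf
  | succ k ih => rw [Function.iterate_succ_apply']; exact ih.backOp

lemma backOp_mono {f g : ℝ → ℝ} {c : ℝ} (hf : IsUnitProfile f) (hg : IsUnitProfile g)
    (h : ∀ x, f x ≤ c * g x) (x : ℝ) : backOp lam f x ≤ c * backOp lam g x := by
  unfold backOp
  rw [← integral_const_mul]
  exact integral_mono (hf.integrable x) ((hg.integrable x).const_mul c) fun φ => h _

lemma iterate_backOp_mono {f g : ℝ → ℝ} {c : ℝ} (hf : IsUnitProfile f) (hg : IsUnitProfile g)
    (h : ∀ x, f x ≤ c * g x) (k : ℕ) (x : ℝ) :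
    (backOp lam)^[k] f x ≤ c * (backOp lam)^[k] g x := by
  induction k generalizing x with
  | zero => exact h x
  | succ k ih =>
    rw [Function.iterate_succ_apply', Function.iterate_succ_apply']
    exact backOp_mono (hf.iterate k) (hg.iterate k) ih x

lemma isUnitProfile_decay (hγ : 0 ≤ γ) : IsUnitProfile (decay γ) :=
  ⟨continuous_decay γ, fun x => (decay_pos γ x).le, decay_le_one hγ⟩

lemma decay_invAct_le (hγ : 0 ≤ γ) (hγ1 : γ ≤ 1) (φ : AffP) (x : ℝ) :
    decay γ (invAct φ x) ≤
      decay γ x * (φ.1.1 ^ γ + (1 + |φ.1.2|) ^ γ * decay γ (invAct φ x)) := by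
  set y := invAct φ x with hy
  have hxy : x = φ.1.1 * y + φ.1.2 := by
    have := φ.2.ne'
    rw [hy, invAct]; field_simp; ring
  have hp : ∀ z : ℝ, 0 < 1 + |z| := fun z => by positivity
  have hdec : ∀ z, decay γ z = ((1 + |z|) ^ γ)⁻¹ := fun z => Real.rpow_neg (hp z).le γ
  have h1 : (1 + |x|) ^ γ ≤ φ.1.1 ^ γ * (1 + |y|) ^ γ + (1 + |φ.1.2|) ^ γ := by
    rw [← Real.mul_rpow φ.2.le (hp y).le]
    refine le_trans ?_ (Real.rpow_add_le_add_rpow (mul_nonneg φ.2.le (hp y).le) (hp _).le hγ hγ1)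
    refine Real.rpow_le_rpow (hp x).le ?_ hγ
    have h2 := abs_add_le (φ.1.1 * y) φ.1.2
    rw [abs_mul, abs_of_pos φ.2, ← hxy] at h2
    nlinarith [φ.2]
  have hx := Real.rpow_pos_of_pos (hp x) γ
  have hyp := Real.rpow_pos_of_pos (hp y) γ
  rw [hdec, hdec, ← mul_le_mul_iff_left₀ (mul_pos hx hyp)]
  calc ((1 + |y|) ^ γ)⁻¹ * ((1 + |x|) ^ γ * (1 + |y|) ^ γ) = (1 + |x|) ^ γ := by field_simp
    _ ≤ _ := h1
    _ = _ := by field_simp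

/-- Far from the origin the profile is contracted by the transition operator. -/
lemma exists_backOp_decay_le (hγ : 0 < γ) (hγ1 : γ ≤ 1)
    (hr : Integrable (fun φ : AffP => φ.1.1 ^ γ) lam)
    (hb : Integrable (fun φ : AffP => |φ.1.2| ^ γ) lam) {c : ℝ} (hc : ∫ φ, φ.1.1 ^ γ ∂lam < c) :
    ∃ R : ℝ, 0 ≤ R ∧ ∀ x : ℝ, R < |x| → backOp lam (decay γ) x ≤ c * decay γ x := by
  have hbm : Measurable fun φ : AffP => (1 + |φ.1.2|) ^ γ :=
    (measurable_const.add measurable_shift.abs).pow_const _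
  have hb0 : ∀ φ : AffP, 0 ≤ (1 + |φ.1.2|) ^ γ := fun φ => Real.rpow_nonneg (by positivity) _
  have hb' : Integrable (fun φ : AffP => (1 + |φ.1.2|) ^ γ) lam := by
    refine ((integrable_const (1 : ℝ)).add hb).mono' hbm.aestronglyMeasurable
      (Eventually.of_forall fun φ => ?_)
    rw [Real.norm_of_nonneg (hb0 φ)]
    simpa using Real.rpow_add_le_add_rpow zero_le_one (abs_nonneg φ.1.2) hγ.le hγ1
  have hdm : ∀ x, Measurable fun φ => decay γ (invAct φ x) := fun x =>
    (continuous_decay γ).measurable.comp (measurable_invAct x)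
  have hbound : ∀ x (φ : AffP), ‖(1 + |φ.1.2|) ^ γ * decay γ (invAct φ x)‖ ≤
      (1 + |φ.1.2|) ^ γ := fun x φ => by
    rw [Real.norm_of_nonneg (mul_nonneg (hb0 φ) (decay_pos _ _).le)]
    exact mul_le_of_le_one_right (hb0 φ) (decay_le_one hγ.le _)
  have hlim : Tendsto (fun x => ∫ φ : AffP, (1 + |φ.1.2|) ^ γ * decay γ (invAct φ x) ∂lam)
      (comap abs atTop) (𝓝 (∫ φ : AffP, (1 + |φ.1.2|) ^ γ * 0 ∂lam)) := by
    refine tendsto_integral_filter_of_dominated_convergence (fun φ => (1 + |φ.1.2|) ^ γ)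
      (Eventually.of_forall fun x => (hbm.mul (hdm x)).aestronglyMeasurable)
      (Eventually.of_forall fun x => Eventually.of_forall fun φ => hbound x φ) hb'
      (Eventually.of_forall fun φ => Tendsto.const_mul _ ((tendsto_decay hγ).comp ?_))
    rw [tendsto_comap_iff]
    have h1 := tendsto_comap_iff.mp (tendsto_abs_sub_const φ.1.2)
    refine (h1.atTop_div_const φ.2).congr fun x => ?_
    simp only [Function.comp_apply, invAct, abs_div, abs_of_pos φ.2]
  simp only [mul_zero, integral_zero] at hlim
  obtain ⟨S, hS, hSx⟩ := mem_comap.mp (hlim.eventually (gt_mem_nhds (sub_pos.mpr hc)))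
  obtain ⟨R, hR⟩ := mem_atTop_sets.mp hS
  refine ⟨max R 0, le_max_right _ _, fun x hx => ?_⟩
  have hx1 := hSx (hR |x| ((le_max_left R 0).trans hx.le))
  simp only [Set.mem_ofPred_eq] at hx1
  have hi : Integrable (fun φ : AffP => (1 + |φ.1.2|) ^ γ * decay γ (invAct φ x)) lam :=
    hb'.mono' (hbm.mul (hdm x)).aestronglyMeasurable (Eventually.of_forall (hbound x))
  calc backOp lam (decay γ) x
      ≤ ∫ φ, decay γ x * (φ.1.1 ^ γ + (1 + |φ.1.2|) ^ γ * decay γ (invAct φ x)) ∂lam :=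
        integral_mono ((isUnitProfile_decay hγ.le).integrable x) ((hr.add hi).const_mul _)
          fun φ => decay_invAct_le hγ.le hγ1 φ x
    _ = decay γ x * (∫ φ, φ.1.1 ^ γ ∂lam +
          ∫ φ : AffP, (1 + |φ.1.2|) ^ γ * decay γ (invAct φ x) ∂lam) := by
        rw [integral_const_mul, integral_add hr hi]
    _ ≤ c * decay γ x := by
        rw [mul_comm]
        exact mul_le_mul_of_nonneg_right (by linarith) (decay_pos γ x).le

/-- A profile dominating `decay γ` which is uniformly contracted by some power of the transition
operator. -/
lemma exists_contracted_profile (hγ : 0 < γ) (hγ1 : γ ≤ 1)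
    (hfix : ∀ t : ℝ, ¬ ∀ᵐ φ ∂lam, φ.1.1 * t + φ.1.2 = t)
    (hint : Integrable (fun φ : AffP => Real.log φ.1.1) lam)
    (hle : ∫ φ, Real.log φ.1.1 ∂lam ≤ 0)
    (hr : Integrable (fun φ : AffP => φ.1.1 ^ γ) lam) (hκ : ∫ φ, φ.1.1 ^ γ ∂lam < 1)
    (hb : Integrable (fun φ : AffP => |φ.1.2| ^ γ) lam) :
    ∃ (W : ℝ → ℝ) (k : ℕ) (θ : ℝ), IsUnitProfile W ∧ (∀ x, decay γ x ≤ W x) ∧ 0 < k ∧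
      θ < 1 ∧ ∀ x, (backOp lam)^[k] W x ≤ θ * W x := by
  obtain ⟨c, hc, hc1⟩ := exists_between hκ
  obtain ⟨R, hR, hfar⟩ := exists_backOp_decay_le hγ hγ1 hr hb hc
  have hc0 : 0 ≤ c := (integral_nonneg fun φ => Real.rpow_nonneg φ.2.le γ).trans hc.le
  have hD := isUnitProfile_decay hγ.le
  set L : ℝ := (1 + R) ^ γ with hL
  have hL1 : 1 ≤ L := Real.one_le_rpow (by linarith) hγ.le
  set W : ℝ → ℝ := fun x => min 1 (L * decay γ x) with hWdef
  have hW : IsUnitProfile W :=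
    ⟨continuous_const.min (continuous_const.mul hD.1),
      fun x => le_min zero_le_one (mul_nonneg (by linarith) (hD.2.1 x)), fun x => min_le_left _ _⟩
  have hLd : ∀ x, L * decay γ x = ((1 + R) / (1 + |x|)) ^ γ := fun x => by
    rw [Real.div_rpow (by linarith) (by positivity), decay, Real.rpow_neg (by positivity),
      div_eq_mul_inv]
  have hWin : ∀ x, |x| ≤ R → W x = 1 := fun x hx => by
    refine min_eq_left ?_
    rw [hLd]
    exact Real.one_le_rpow ((one_le_div (by positivity)).mpr (by linarith)) hγ.le
  have hWout : ∀ x, R < |x| → W x = L * decay γ x ∧ W x < 1 := fun x hx => by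
    have : L * decay γ x < 1 := by
      rw [hLd]
      exact Real.rpow_lt_one (by positivity) ((div_lt_one (by positivity)).mpr (by linarith)) hγ
    exact ⟨min_eq_right this.le, (min_le_right _ _).trans_lt this⟩
  have hWfar : ∀ x, R < |x| → backOp lam W x ≤ c * W x := fun x hx => by
    calc backOp lam W x ≤ L * backOp lam (decay γ) x :=
          backOp_mono hW hD (fun y => min_le_right _ _) x
      _ ≤ L * (c * decay γ x) := mul_le_mul_of_nonneg_left (hfar x hx) (by linarith)
      _ = c * W x := by rw [(hWout x hx).1]; ring
  have hWle : ∀ x, backOp lam W x ≤ 1 * W x := fun x => by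
    rcases le_or_gt |x| R with hx | hx
    · rw [hWin x hx, one_mul]; exact (hW.backOp (lam := lam)).2.2 x
    · exact (hWfar x hx).trans (mul_le_mul_of_nonneg_right hc1.le (hW.2.1 x))
  set P : ℕ → ℝ → ℝ := fun k => (backOp lam)^[k] W with hP
  have hPu : ∀ k, IsUnitProfile (P k) := fun k => hW.iterate k
  have hPsucc : ∀ k x, P (k + 1) x = ∫ φ, P k (invAct φ x) ∂lam := fun k x => by
    simp only [hP, Function.iterate_succ_apply']; rfl
  have hPanti : ∀ k x, P (k + 1) x ≤ P k x := fun k x => by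
    have := iterate_backOp_mono (lam := lam) hW.backOp hW hWle k x
    rwa [one_mul, ← Function.iterate_succ_apply] at this
  have hPanti' : ∀ x, Antitone fun k => P k x := fun x =>
    antitone_nat_of_succ_le fun k => hPanti k x
  obtain ⟨k, hk⟩ : ∃ k, ∀ x, P k x < 1 := by
    by_contra! hne
    set t : ℕ → Set ℝ := fun k => {x | 1 ≤ P k x} with ht
    have htc : ∀ k, IsClosed (t k) := fun k => isClosed_le continuous_const (hPu k).1
    have ht0 : IsCompact (t 0) := by
      refine Metric.isCompact_of_isClosed_isBounded (htc 0)
        ((Metric.isBounded_closedBall (x := (0 : ℝ)) (r := R)).subset fun x hx => ?_)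
      rw [mem_closedBall_zero_iff, Real.norm_eq_abs]
      by_contra! hlt
      exact absurd (hWout x hlt).2 (not_lt.mpr hx)
    have hK := IsCompact.nonempty_iInter_of_sequence_nonempty_isCompact_isClosed t
      (fun k x hx => le_trans hx (hPanti k x)) hne ht0 htc
    refine not_stable_compact hfix hint hle
      (ht0.of_isClosed_subset (isClosed_iInter htc) (Set.iInter_subset t 0)) hK fun x hx => ?_
    simp only [Set.mem_iInter]
    refine ae_all_iff.mpr fun k => ?_
    have hx1 : 1 ≤ P (k + 1) x := Set.mem_iInter.mp hx (k + 1)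
    have hz : ∫ φ, (1 - P k (invAct φ x)) ∂lam = 0 := by
      rw [integral_sub (integrable_const _) ((hPu k).integrable x), ← hPsucc]
      simp only [integral_const, probReal_univ, one_smul]
      linarith [(hPu (k + 1)).2.2 x]
    have h2 := (integral_eq_zero_iff_of_nonneg
      (fun φ => sub_nonneg.mpr ((hPu k).2.2 (invAct φ x)))
      ((integrable_const _).sub ((hPu k).integrable x))).mp hz
    filter_upwards [h2] with φ h
    exact (sub_eq_zero.mp h).le
  obtain ⟨z, -, hz⟩ := (isCompact_Icc (a := -R) (b := R)).exists_isMaxOn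
    ⟨0, by constructor <;> linarith⟩ (hPu k).1.continuousOn
  refine ⟨W, k + 1, max (P k z) c, hW, fun x => le_min (hD.2.2 x) ?_, k.succ_pos,
    max_lt (hk z) hc1, fun x => ?_⟩
  · exact le_mul_of_one_le_left (hD.2.1 x) hL1
  · rcases le_or_gt |x| R with hx | hx
    · rw [hWin x hx, mul_one]
      exact (hPanti k x).trans ((hz (abs_le.mp hx)).trans (le_max_left _ _))
    · calc P (k + 1) x ≤ P 1 x := hPanti' x (by omega)
        _ ≤ c * W x := hWfar x hx
        _ ≤ _ := mul_le_mul_of_nonneg_right (le_max_right _ _) (hW.2.1 x)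

end BackOp

section Regularity

variable {lam : Measure AffP} [IsProbabilityMeasure lam]

lemma iterLaw_succ_Icc (n : ℕ) (x ρ : ℝ) :
    iterLaw lam (n + 1) (Set.Icc (x - ρ) (x + ρ)) =
      ∫⁻ φ : AffP, iterLaw lam n
        (Set.Icc (invAct φ x - ρ / φ.1.1) (invAct φ x + ρ / φ.1.1)) ∂lam := by
  rw [iterLaw, Measure.map_apply measurable_affine measurableSet_Icc,
    Measure.prod_apply (measurable_affine measurableSet_Icc)]
  refine lintegral_congr fun φ => ?_
  rw [← preimage_Icc_affine]
  rfl

/-- Transfer of a uniform ball estimate through iterations of the transition operator. -/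
lemma iterLaw_add_Icc_le {W : ℝ → ℝ} (hW : IsUnitProfile W) {C δ A : ℝ} (hC : 0 ≤ C)
    (hA : 0 ≤ A) (hδ : Integrable (fun φ : AffP => φ.1.1 ^ (-δ)) lam)
    (hδA : ∫ φ, φ.1.1 ^ (-δ) ∂lam ≤ A)
    (hbase : ∀ (n : ℕ) (x ρ : ℝ), 0 < ρ →
      iterLaw lam n (Set.Icc (x - ρ) (x + ρ)) ≤ ENNReal.ofReal (C * (W x + ρ ^ δ)))
    (m n : ℕ) (x : ℝ) {ρ : ℝ} (hρ : 0 < ρ) :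
    iterLaw lam (n + m) (Set.Icc (x - ρ) (x + ρ)) ≤
      ENNReal.ofReal (C * ((backOp lam)^[m] W x + ρ ^ δ * A ^ m)) := by
  induction m generalizing x ρ with
  | zero => simpa using hbase n x ρ hρ
  | succ m ih =>
    have hu := hW.iterate (lam := lam) m
    have hρδ : 0 ≤ ρ ^ δ := Real.rpow_nonneg hρ.le _
    have hi : Integrable (fun φ : AffP => C * ((backOp lam)^[m] W (invAct φ x) +
        ρ ^ δ * A ^ m * φ.1.1 ^ (-δ))) lam := ((hu.integrable x).add (hδ.const_mul _)).const_mul C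
    rw [← add_assoc, iterLaw_succ_Icc]
    calc ∫⁻ φ : AffP, iterLaw lam (n + m)
          (Set.Icc (invAct φ x - ρ / φ.1.1) (invAct φ x + ρ / φ.1.1)) ∂lam
        ≤ ∫⁻ φ : AffP, ENNReal.ofReal (C * ((backOp lam)^[m] W (invAct φ x) +
            ρ ^ δ * A ^ m * φ.1.1 ^ (-δ))) ∂lam := by
          refine lintegral_mono fun φ => (ih (invAct φ x) (div_pos hρ φ.2)).trans_eq ?_
          rw [Real.div_rpow hρ.le φ.2.le, Real.rpow_neg φ.2.le]
          congr 2
          ring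
      _ = ENNReal.ofReal (∫ φ : AffP, C * ((backOp lam)^[m] W (invAct φ x) +
            ρ ^ δ * A ^ m * φ.1.1 ^ (-δ)) ∂lam) := by
          refine (ofReal_integral_eq_lintegral_ofReal hi (Eventually.of_forall fun φ => ?_)).symm
          exact mul_nonneg hC (add_nonneg (hu.2.1 _)
            (mul_nonneg (mul_nonneg hρδ (pow_nonneg hA m)) (Real.rpow_nonneg φ.2.le _)))
      _ ≤ _ := by
          refine ENNReal.ofReal_le_ofReal ?_
          rw [integral_const_mul, integral_add (hu.integrable x) (hδ.const_mul _),
            integral_const_mul, Function.iterate_succ_apply']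
          refine mul_le_mul_of_nonneg_left (add_le_add le_rfl ?_) hC
          rw [pow_succ, ← mul_assoc]
          exact mul_le_mul_of_nonneg_left hδA (mul_nonneg hρδ (pow_nonneg hA m))

lemma iterate_mul_backOp_le {W : ℝ → ℝ} (hW : IsUnitProfile W) {k : ℕ} {θ : ℝ} (hθ : 0 ≤ θ)
    (h : ∀ x, (backOp lam)^[k] W x ≤ θ * W x) (j : ℕ) (x : ℝ) :
    (backOp lam)^[k * j] W x ≤ θ ^ j := by
  have key : (backOp lam)^[k * j] W x ≤ θ ^ j * W x := by
    induction j generalizing x with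
    | zero => simp
    | succ j ih =>
      rw [mul_add, mul_one, Function.iterate_add_apply]
      refine (iterate_backOp_mono (hW.iterate k) hW h (k * j) x).trans ?_
      rw [pow_succ', mul_assoc]
      exact mul_le_mul_of_nonneg_left (ih x) hθ
  exact key.trans (mul_le_of_le_one_right (pow_nonneg hθ j) (hW.2.2 x))

end Regularity

/-- Optimizing the number of steps turns exponential estimates into a power of the scale. -/
lemma exists_scale_exponent {θ D δ γ₀ : ℝ} {k : ℕ} (hθ0 : 0 < θ) (hθ1 : θ < 1) (hD : 1 ≤ D)
    (hδ : 0 < δ) (hγ₀ : 0 < γ₀) (hk : 0 < k) :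
    ∃ γ : ℝ, 0 < γ ∧ γ ≤ γ₀ ∧ ∀ (n : ℕ) (ρ : ℝ), Real.exp (-(n : ℝ)) < ρ → ρ ≤ 1 →
      ∃ j : ℕ, k * j ≤ n ∧ θ ^ j + ρ ^ δ * D ^ j ≤ (θ⁻¹ + 1) * ρ ^ γ := by
  have hk' : (0 : ℝ) < k := by exact_mod_cast hk
  have hlD : 0 ≤ Real.log D := Real.log_nonneg hD
  have hlθ : Real.log θ < 0 := Real.log_neg hθ0 hθ1
  set η : ℝ := min (1 / k) (δ / (2 * (Real.log D + 1))) with hη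
  have hη0 : 0 < η := lt_min (by positivity) (by positivity)
  have hηk : k * η ≤ 1 := by
    have := min_le_left (1 / (k : ℝ)) (δ / (2 * (Real.log D + 1)))
    rw [← hη, le_div_iff₀ hk'] at this
    linarith
  have hηD : η * Real.log D ≤ δ / 2 := by
    have := min_le_right (1 / (k : ℝ)) (δ / (2 * (Real.log D + 1)))
    rw [← hη, le_div_iff₀ (by positivity)] at this
    nlinarith
  set γ : ℝ := min γ₀ (min (δ / 2) (-η * Real.log θ)) with hγ
  have hγ1 : γ ≤ δ / 2 := (min_le_right _ _).trans (min_le_left _ _)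
  have hγ2 : γ ≤ -η * Real.log θ := (min_le_right _ _).trans (min_le_right _ _)
  refine ⟨γ, lt_min hγ₀ (lt_min (by positivity) (by nlinarith)), min_le_left _ _,
    fun n ρ hn hρ1 => ?_⟩
  have hρ : 0 < ρ := (Real.exp_pos _).trans hn
  set T : ℝ := -Real.log ρ with hT
  have hT0 : 0 ≤ T := neg_nonneg.mpr (Real.log_nonpos hρ.le hρ1)
  have hTn : T ≤ n := by
    have := (Real.lt_log_iff_exp_lt hρ).mpr hn
    linarith
  have hrpow : ∀ a : ℝ, ρ ^ a = Real.exp (-T * a) := fun a => by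
    rw [Real.rpow_def_of_pos hρ, hT, neg_neg]
  have hpow : ∀ (a : ℝ) (j : ℕ), 0 < a → a ^ j = Real.exp (j * Real.log a) := fun a j ha => by
    rw [Real.exp_nat_mul, Real.exp_log ha]
  have hj1 : (⌊η * T⌋₊ : ℝ) ≤ η * T := Nat.floor_le (by positivity)
  have hj2 : η * T < ⌊η * T⌋₊ + 1 := Nat.lt_floor_add_one _
  refine ⟨⌊η * T⌋₊, ?_, ?_⟩
  · have : (k : ℝ) * ⌊η * T⌋₊ ≤ n := by nlinarith
    exact_mod_cast this
  · have h1 : θ ^ ⌊η * T⌋₊ ≤ θ⁻¹ * ρ ^ γ := by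
      rw [hpow θ _ hθ0, hrpow, ← Real.exp_log (inv_pos.mpr hθ0), Real.log_inv, ← Real.exp_add]
      refine Real.exp_le_exp.mpr ?_
      nlinarith
    have h2 : ρ ^ δ * D ^ ⌊η * T⌋₊ ≤ ρ ^ γ := by
      rw [hpow D _ (by linarith), hrpow, hrpow, ← Real.exp_add]
      refine Real.exp_le_exp.mpr ?_
      nlinarith
    linarith

/-- Uniform moment and Hölder-regularity of the measures `σ⁽ⁿ⁾` (at scales above `e^{-n}`). -/
theorem iterLaw_moment_and_holder
    (lam : Measure AffP) [IsProbabilityMeasure lam]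
    (hmom : ∃ ε : ℝ, 0 < ε ∧
      ∫⁻ φ : AffP, ENNReal.ofReal (φ.1.1 ^ ε + φ.1.1 ^ (-ε) + |φ.1.2| ^ ε) ∂lam < ⊤)
    (hnofix : ¬ ∃ t : ℝ, ∀ φ ∈ msupport lam, φ.1.1 * t + φ.1.2 = t)
    (σ : Measure ℝ) [IsProbabilityMeasure σ]
    (hstat : ∀ A : Set ℝ, MeasurableSet A →
      σ A = ∫⁻ φ : AffP, σ ((fun t => φ.1.1 * t + φ.1.2) ⁻¹' A) ∂lam) :
    ∃ γ : ℝ, 0 < γ ∧ ∃ C : ℝ, 0 < C ∧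
      (∀ n : ℕ, 1 ≤ n →
        ∫⁻ s : ℝ, ENNReal.ofReal (|s| ^ γ) ∂(iterLaw lam n) ≤ ENNReal.ofReal C) ∧
      (∀ n : ℕ, 1 ≤ n → ∀ r : ℝ, Real.exp (-(n : ℝ)) < r → ∀ s : ℝ,
        iterLaw lam n (Set.Icc (s - r) (s + r)) ≤ ENNReal.ofReal (C * r ^ γ)) := by
  obtain ⟨ε, hε, hmomε⟩ := hmom
  have hst : IsStationaryFor lam σ := hstat
  have hfix := not_ae_fixed hnofix
  obtain ⟨hr1, hr2, hb⟩ := integrable_moments hmomε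
  have hint0 := zero_mem_interior_integrableExpSet hε hr1 hr2
  have hlog : Integrable (fun φ : AffP => Real.log φ.1.1) lam := by
    simpa using ProbabilityTheory.integrable_pow_of_mem_interior_integrableExpSet hint0 1
  have hneg := hst.integral_log_neg hfix hlog
  set δ : ℝ := min ε 1 with hδdef
  have hδ : 0 < δ := lt_min hε one_pos
  obtain ⟨γ₀, hγ₀, hγδ, hr, hκ⟩ := exists_contracting_moment hint0 hneg hδ
  have hγ1 : γ₀ ≤ 1 := hγδ.trans (min_le_right _ _)
  have hb₀ : Integrable (fun φ : AffP => |φ.1.2| ^ γ₀) lam := by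
    refine ((integrable_const (1 : ℝ)).add hb).mono'
      (measurable_shift.abs.pow_const _).aestronglyMeasurable (Eventually.of_forall fun φ => ?_)
    rw [Real.norm_of_nonneg (Real.rpow_nonneg (abs_nonneg _) _)]
    exact rpow_le_one_add_rpow (abs_nonneg _) hγ₀.le (hγδ.trans (min_le_left _ _))
  have hrδ : Integrable (fun φ : AffP => φ.1.1 ^ (-δ)) lam := by
    refine ((integrable_const (1 : ℝ)).add hr2).mono'
      (measurable_slope.pow_const _).aestronglyMeasurable (Eventually.of_forall fun φ => ?_)
    rw [Real.norm_of_nonneg (Real.rpow_nonneg φ.2.le _), Real.rpow_neg φ.2.le,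
      ← Real.inv_rpow φ.2.le]
    simp only [Pi.add_apply]
    rw [Real.rpow_neg φ.2.le, ← Real.inv_rpow φ.2.le]
    exact rpow_le_one_add_rpow (inv_nonneg.mpr φ.2.le) hδ.le (min_le_left _ _)
  set M : ℝ := (∫ φ, |φ.1.2| ^ γ₀ ∂lam) / (1 - ∫ φ, φ.1.1 ^ γ₀ ∂lam)
  have hM : 0 ≤ M := div_nonneg
    (integral_nonneg fun φ => Real.rpow_nonneg (abs_nonneg _) _) (by linarith)
  have hmom₀ : ∀ n, ∫⁻ s, ENNReal.ofReal (|s| ^ γ₀) ∂(iterLaw lam n) ≤ ENNReal.ofReal M :=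
    lintegral_rpow_iterLaw_le hγ₀ hγ1 hr hκ hb₀
  obtain ⟨W, k, θ', hW, hdW, hk, hθ', hcontr'⟩ :=
    exists_contracted_profile hγ₀ hγ1 hfix hlog hneg.le hr hκ hb₀
  set θ : ℝ := max θ' (1 / 2)
  have hθ0 : 0 < θ := lt_max_of_lt_right (by norm_num)
  have hθ1 : θ < 1 := max_lt hθ' (by norm_num)
  have hcontr : ∀ x, (backOp lam)^[k] W x ≤ θ * W x := fun x =>
    (hcontr' x).trans (mul_le_mul_of_nonneg_right (le_max_left _ _) (hW.2.1 x))
  set A : ℝ := max (∫ φ, φ.1.1 ^ (-δ) ∂lam) 1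
  have hA : 1 ≤ A := le_max_right _ _
  have hbase : ∀ (n : ℕ) (x ρ : ℝ), 0 < ρ →
      iterLaw lam n (Set.Icc (x - ρ) (x + ρ)) ≤
        ENNReal.ofReal ((4 * M + 2) * (W x + ρ ^ δ)) := fun n x ρ hρ =>
    (iterLaw_Icc_le_decay hγ₀ hγ1 hδ (min_le_right _ _) hM (hmom₀ n) x hρ).trans
      (ENNReal.ofReal_le_ofReal
        (mul_le_mul_of_nonneg_left (by linarith [hdW x]) (by linarith)))
  obtain ⟨γ, hγ, hγγ₀, hscale⟩ := exists_scale_exponent hθ0 hθ1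
    (one_le_pow₀ hA : 1 ≤ A ^ k) hδ hγ₀ hk
  have hθinv : 0 < θ⁻¹ := inv_pos.mpr hθ0
  refine ⟨γ, hγ, (4 * M + 2) * (θ⁻¹ + 1), by positivity, fun n _ => ?_, fun n _ r hrn s => ?_⟩
  · calc ∫⁻ s : ℝ, ENNReal.ofReal (|s| ^ γ) ∂(iterLaw lam n)
        ≤ ∫⁻ s : ℝ, (1 + ENNReal.ofReal (|s| ^ γ₀)) ∂(iterLaw lam n) := by
          refine lintegral_mono fun s => ?_
          rw [← ENNReal.ofReal_one, ← ENNReal.ofReal_add zero_le_one (by positivity)]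
          exact ENNReal.ofReal_le_ofReal (rpow_le_one_add_rpow (abs_nonneg s) hγ.le hγγ₀)
      _ = 1 + ∫⁻ s : ℝ, ENNReal.ofReal (|s| ^ γ₀) ∂(iterLaw lam n) := by
          rw [lintegral_add_left measurable_const]; simp
      _ ≤ 1 + ENNReal.ofReal M := by gcongr; exact hmom₀ n
      _ = ENNReal.ofReal (1 + M) := by rw [ENNReal.ofReal_add zero_le_one hM, ENNReal.ofReal_one]
      _ ≤ _ := ENNReal.ofReal_le_ofReal (by nlinarith)
  · rcases le_or_gt r 1 with hr1' | hr1'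
    · obtain ⟨j, hj, hjle⟩ := hscale n r hrn hr1'
      have hr0 : 0 < r := (Real.exp_pos _).trans hrn
      have h := iterLaw_add_Icc_le hW (by linarith : 0 ≤ 4 * M + 2) (by linarith) hrδ
        (le_max_left _ 1) hbase (k * j) (n - k * j) s hr0
      rw [Nat.sub_add_cancel hj] at h
      refine h.trans (ENNReal.ofReal_le_ofReal ?_)
      rw [mul_assoc]
      refine mul_le_mul_of_nonneg_left (le_trans ?_ hjle) (by linarith)
      rw [pow_mul A]
      exact add_le_add (iterate_mul_backOp_le hW hθ0.le hcontr j s) le_rfl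
    · refine prob_le_one.trans ?_
      rw [← ENNReal.ofReal_one]
      refine ENNReal.ofReal_le_ofReal ?_
      have h1 : 1 ≤ r ^ γ := Real.one_le_rpow hr1'.le hγ.le
      have h2 : 1 ≤ (4 * M + 2) * (θ⁻¹ + 1) := by nlinarith
      nlinarith
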